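/- (Partial derivative of the inverse binary KL divergence in its second argument.) Fix q ∈ (0,1) and ε ∈ (0,∞), and let p := kl⁻¹(q,ε), so q < p < 1. Then the function ε' ↦ kl⁻¹(q,ε') is differentiable at ε with derivative ∂ kl⁻¹(q,ε)/∂ε = 1 / ( (1−q)/(1−p) − q/p ). -/

import Mathlib

open MeasureTheory ENNReal NNReal
open scoped Classical

/-- Binary KL divergence `kl(q‖p)`, with the conventions `0 · ln 0 = 0` and
`kl(q‖p) = +∞` when `p ∈ {0,1}` and `q ≠ p`. -/
noncomputable def bkl (q p : ℝ) : ℝ≥0∞ :=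
  if q = p then 0
  else if p = 0 ∨ p = 1 then ⊤
  else ENNReal.ofReal (q * Real.log (q / p) + (1 - q) * Real.log ((1 - q) / (1 - p)))

/-- Inverse binary KL divergence `kl⁻¹(q,ε) = max{p ∈ [0,1] : kl(q‖p) ≤ ε}`
(defined as a supremum; its attainment is part of the theorem below). -/
noncomputable def klInv (q : ℝ) (ε : ℝ≥0∞) : ℝ :=
  sSup {p | p ∈ Set.Icc (0 : ℝ) 1 ∧ bkl q p ≤ ε}

/-- The real-valued formula for the binary KL divergence at interior points. -/
noncomputable def bklReal (q p : ℝ) : ℝ :=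
  q * Real.log (q / p) + (1 - q) * Real.log ((1 - q) / (1 - p))

lemma bklReal_self {q : ℝ} (hq : q ∈ Set.Ioo (0 : ℝ) 1) : bklReal q q = 0 := by
  have h : 1 - q ≠ 0 := (sub_pos.2 hq.2).ne'
  simp [bklReal, div_self hq.1.ne', div_self h]

lemma hasDerivAt_bklReal {q p : ℝ} (hq : q ∈ Set.Ioo (0 : ℝ) 1) (hp : p ∈ Set.Ioo (0 : ℝ) 1) :
    HasDerivAt (bklReal q) ((1 - q) / (1 - p) - q / p) p := by
  have hq0 : q ≠ 0 := hq.1.ne'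
  have hq1 : 1 - q ≠ 0 := (sub_pos.2 hq.2).ne'
  have hp0 : p ≠ 0 := hp.1.ne'
  have hp1 : 1 - p ≠ 0 := (sub_pos.2 hp.2).ne'
  have h₁ := (((hasDerivAt_const p q).div (hasDerivAt_id p) hp0).log
    (div_ne_zero hq0 hp0)).const_mul q
  have h₂ := (((hasDerivAt_const p (1 - q)).div ((hasDerivAt_id p).const_sub 1) hp1).log
    (div_ne_zero hq1 hp1)).const_mul (1 - q)
  refine (h₁.add h₂).congr_deriv ?_
  simp only [Pi.div_apply, id]
  field_simp
  ring

lemma deriv_bklReal_pos {q p : ℝ} (hq : 0 < q) (hp : p ∈ Set.Ioo q 1) :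
    0 < (1 - q) / (1 - p) - q / p := by
  have h₁ : 1 < (1 - q) / (1 - p) := by
    rw [one_lt_div (sub_pos.2 hp.2)]
    linarith [hp.1]
  have h₂ : q / p < 1 := (div_lt_one (hq.trans hp.1)).2 hp.1
  linarith

lemma continuousOn_bklReal {q : ℝ} (hq : q ∈ Set.Ioo (0 : ℝ) 1) :
    ContinuousOn (bklReal q) (Set.Ico q 1) := fun _ hx =>
  (hasDerivAt_bklReal hq ⟨hq.1.trans_le hx.1, hx.2⟩).continuousAt.continuousWithinAt

lemma strictMonoOn_bklReal {q : ℝ} (hq : q ∈ Set.Ioo (0 : ℝ) 1) :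
    StrictMonoOn (bklReal q) (Set.Ico q 1) := by
  refine strictMonoOn_of_deriv_pos (convex_Ico q 1) (continuousOn_bklReal hq) fun x hx => ?_
  rw [interior_Ico] at hx
  rw [(hasDerivAt_bklReal hq ⟨hq.1.trans hx.1, hx.2⟩).deriv]
  exact deriv_bklReal_pos hq.1 hx

lemma bklReal_pos {q p : ℝ} (hq : q ∈ Set.Ioo (0 : ℝ) 1) (hp : p ∈ Set.Ioo q 1) :
    0 < bklReal q p := by
  rw [← bklReal_self hq]
  exact strictMonoOn_bklReal hq ⟨le_rfl, hq.2⟩ (Set.Ioo_subset_Ico_self hp) hp.1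

lemma bkl_eq_ofReal {q p : ℝ} (hq : 0 < q) (hp : p ∈ Set.Ioo q 1) :
    bkl q p = ENNReal.ofReal (bklReal q p) := by
  simp [bkl, bklReal, hp.1.ne, (hq.trans hp.1).ne', hp.2.ne]

lemma exists_le_bklReal {q ε : ℝ} (hq : q ∈ Set.Ioo (0 : ℝ) 1) (hε : 0 < ε) :
    ∃ p ∈ Set.Ioo q 1, ε ≤ bklReal q p := by
  have hq1 : 0 < 1 - q := sub_pos.2 hq.2
  have hlog : Real.log q < 0 := Real.log_neg hq.1 hq.2
  set M := (ε - q * Real.log q) / (1 - q) with hM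
  have hMpos : 0 < M := div_pos (by nlinarith [hq.1]) hq1
  have hexp : Real.exp (-M) < 1 := Real.exp_lt_one_iff.2 (neg_lt_zero.2 hMpos)
  have hexp0 : 0 < Real.exp (-M) := Real.exp_pos _
  have hp : 1 - (1 - q) * Real.exp (-M) ∈ Set.Ioo q 1 := ⟨by nlinarith, by nlinarith⟩
  refine ⟨_, hp, ?_⟩
  set p := 1 - (1 - q) * Real.exp (-M) with hpdef
  have hp0 : 0 < p := hq.1.trans hp.1
  have hratio : (1 - q) / (1 - p) = Real.exp M := by
    rw [hpdef, _root_.sub_sub_cancel, Real.exp_neg]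
    field_simp
  have hlogp : Real.log p ≤ 0 := Real.log_nonpos hp0.le hp.2.le
  have hmul : (1 - q) * M = ε - q * Real.log q := by
    rw [hM]
    field_simp
  rw [bklReal, hratio, Real.log_exp, hmul, Real.log_div hq.1.ne' hp0.ne']
  nlinarith [hq.1]

lemma exists_bklReal_eq {q ε : ℝ} (hq : q ∈ Set.Ioo (0 : ℝ) 1) (hε : 0 < ε) :
    ∃ p ∈ Set.Ioo q 1, bklReal q p = ε := by
  obtain ⟨b, hb, hεb⟩ := exists_le_bklReal hq hε
  obtain ⟨p, hp, hpε⟩ := intermediate_value_Ioc hb.1.le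
    ((continuousOn_bklReal hq).mono fun x hx => ⟨hx.1, hx.2.trans_lt hb.2⟩)
    (show ε ∈ Set.Ioc (bklReal q q) (bklReal q b) from ⟨by rwa [bklReal_self hq], hεb⟩)
  exact ⟨p, ⟨hp.1, hp.2.trans_lt hb.2⟩, hpε⟩

lemma klInv_bklReal {q p : ℝ} (hq : q ∈ Set.Ioo (0 : ℝ) 1) (hp : p ∈ Set.Ioo q 1) :
    klInv q (ENNReal.ofReal (bklReal q p)) = p := by
  refine IsGreatest.csSup_eq ⟨⟨⟨(hq.1.trans hp.1).le, hp.2.le⟩, (bkl_eq_ofReal hq.1 hp).le⟩, ?_⟩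
  rintro x ⟨hx, hle⟩
  by_contra! hpx
  have hqx : q < x := hp.1.trans hpx
  rcases hx.2.eq_or_lt with rfl | hx1
  · simp [bkl, hq.2.ne] at hle
  · rw [bkl_eq_ofReal hq.1 ⟨hqx, hx1⟩, ENNReal.ofReal_le_ofReal_iff (bklReal_pos hq hp).le] at hle
    exact hle.not_gt
      (strictMonoOn_bklReal hq (Set.Ioo_subset_Ico_self hp) ⟨hqx.le, hx1⟩ hpx)

lemma klInv_mem_Ioo {q ε : ℝ} (hq : q ∈ Set.Ioo (0 : ℝ) 1) (hε : 0 < ε) :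
    klInv q (ENNReal.ofReal ε) ∈ Set.Ioo q 1 := by
  obtain ⟨p, hp, rfl⟩ := exists_bklReal_eq hq hε
  rwa [klInv_bklReal hq hp]

lemma bklReal_klInv {q ε : ℝ} (hq : q ∈ Set.Ioo (0 : ℝ) 1) (hε : 0 < ε) :
    bklReal q (klInv q (ENNReal.ofReal ε)) = ε := by
  obtain ⟨p, hp, rfl⟩ := exists_bklReal_eq hq hε
  rw [klInv_bklReal hq hp]

lemma continuousAt_klInv {q ε : ℝ} (hq : q ∈ Set.Ioo (0 : ℝ) 1) (hε : 0 < ε) :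
    ContinuousAt (fun ε' => klInv q (ENNReal.ofReal ε')) ε := by
  have hmono : StrictMonoOn (fun ε' => klInv q (ENNReal.ofReal ε')) (Set.Ioi 0) := by
    intro a ha b hb hab
    rw [← bklReal_klInv hq ha, ← bklReal_klInv hq hb] at hab
    exact ((strictMonoOn_bklReal hq).lt_iff_lt
      (Set.Ioo_subset_Ico_self (klInv_mem_Ioo hq ha))
      (Set.Ioo_subset_Ico_self (klInv_mem_Ioo hq hb))).1 hab
  refine hmono.continuousAt_of_image_mem_nhds (Ioi_mem_nhds hε) ?_
  have hmem := klInv_mem_Ioo hq hε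
  filter_upwards [Ioo_mem_nhds hmem.1 hmem.2] with x hx
  exact ⟨bklReal q x, bklReal_pos hq hx, klInv_bklReal hq hx⟩

/-- **Partial derivative of the inverse binary KL divergence in its second argument.**
For `q ∈ (0,1)` and `ε ∈ (0,∞)`, with `p := kl⁻¹(q,ε)` one has `q < p < 1` and
`∂ kl⁻¹(q,ε)/∂ε = 1 / ((1−q)/(1−p) − q/p)`. -/
theorem klInv_hasDerivAt_second (q ε : ℝ) (hq : q ∈ Set.Ioo (0 : ℝ) 1) (hε : 0 < ε)
    (p : ℝ) (hp : p = klInv q (ENNReal.ofReal ε)) :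
    q < p ∧ p < 1 ∧
    HasDerivAt (fun ε' => klInv q (ENNReal.ofReal ε'))
      (1 / ((1 - q) / (1 - p) - q / p)) ε := by
  subst hp
  have hmem := klInv_mem_Ioo hq hε
  refine ⟨hmem.1, hmem.2, ?_⟩
  rw [one_div]
  refine HasDerivAt.of_local_left_inverse (continuousAt_klInv hq hε)
    (hasDerivAt_bklReal hq ⟨hq.1.trans hmem.1, hmem.2⟩) (deriv_bklReal_pos hq.1 hmem).ne' ?_
  filter_upwards [Ioi_mem_nhds hε] with y hy
  exact bklReal_klInv hq hy
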